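/- arXiv:2508.17909 — 2 statements merged into one kernel-verified Lean document; each statement's English description precedes it below -/
import Mathlib

section
/- Let ρ be a density matrix on ℂ² ⊗ ℂ². Then ρ is separable if and only if its partial transpose ρ^{T_B} is positive semidefinite. (That is, for bipartite systems of dimension 2×2 the Peres-Horodecki PPT criterion is both necessary and sufficient for separability.) -/
open Matrix
open scoped BigOperators ComplexOrder Kronecker

/-- A density matrix: positive semidefinite with unit trace. -/
def IsDensity {m : Type*} [Fintype m] (ρ : Matrix m m ℂ) : Prop :=
  ρ.PosSemidef ∧ ρ.trace = 1

/-- A bipartite density matrix is separable if it is a finite convex combination of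
Kronecker products of density matrices on the two factors. -/
def Separable {dA dB : ℕ}
    (ρ : Matrix (Fin dA × Fin dB) (Fin dA × Fin dB) ℂ) : Prop :=
  ∃ (n : ℕ) (q : Fin n → ℝ)
    (ρA : Fin n → Matrix (Fin dA) (Fin dA) ℂ)
    (ρB : Fin n → Matrix (Fin dB) (Fin dB) ℂ),
    (∀ j, 0 ≤ q j) ∧ (∑ j, q j) = 1 ∧
    (∀ j, IsDensity (ρA j)) ∧ (∀ j, IsDensity (ρB j)) ∧
    ρ = ∑ j, (q j : ℂ) • (ρA j ⊗ₖ ρB j)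

/-- The partial transpose with respect to the second factor:
`(ρ^{T_B})_{(i,a),(j,b)} = ρ_{(i,b),(j,a)}`. -/
def partialTransposeB {dA dB : ℕ}
    (ρ : Matrix (Fin dA × Fin dB) (Fin dA × Fin dB) ℂ) :
    Matrix (Fin dA × Fin dB) (Fin dA × Fin dB) ℂ :=
  Matrix.of fun p q => ρ (p.1, q.2) (q.1, p.2)

theorem Separable.posSemidef_partialTransposeB {dA dB : ℕ}
    {ρ : Matrix (Fin dA × Fin dB) (Fin dA × Fin dB) ℂ} (h : Separable ρ) :
    (partialTransposeB ρ).PosSemidef := by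
  obtain ⟨n, q, X, Y, hq, -, hX, hY, rfl⟩ := h
  have key : partialTransposeB (∑ j, (q j : ℂ) • (X j ⊗ₖ Y j)) =
      ∑ j, (q j : ℂ) • (X j ⊗ₖ (Y j)ᵀ) := by
    ext p r
    simp [partialTransposeB, Matrix.sum_apply, kroneckerMap_apply]
  rw [key]
  refine posSemidef_sum _ fun j _ => ?_
  exact ((hX j).1.kronecker (hY j).1.transpose).smul (by exact_mod_cast hq j)

/-- The cone of unnormalised separable matrices. -/
def sepCone (dA dB : ℕ) : AddSubmonoid (Matrix (Fin dA × Fin dB) (Fin dA × Fin dB) ℂ) :=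
  AddSubmonoid.closure {M | ∃ (X : Matrix (Fin dA) (Fin dA) ℂ) (Y : Matrix (Fin dB) (Fin dB) ℂ),
    X.PosSemidef ∧ Y.PosSemidef ∧ M = X ⊗ₖ Y}

theorem kronecker_mem_sepCone {dA dB : ℕ} {X : Matrix (Fin dA) (Fin dA) ℂ}
    {Y : Matrix (Fin dB) (Fin dB) ℂ} (hX : X.PosSemidef) (hY : Y.PosSemidef) :
    X ⊗ₖ Y ∈ sepCone dA dB :=
  AddSubmonoid.subset_closure ⟨X, Y, hX, hY, rfl⟩

theorem conj_mem_sepCone {dA dB : ℕ} {M : Matrix (Fin dA × Fin dB) (Fin dA × Fin dB) ℂ}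
    (hM : M ∈ sepCone dA dB) (L : Matrix (Fin dB) (Fin dB) ℂ) :
    ((1 : Matrix (Fin dA) (Fin dA) ℂ) ⊗ₖ L) * M * ((1 : Matrix (Fin dA) (Fin dA) ℂ) ⊗ₖ Lᴴ) ∈
      sepCone dA dB := by
  induction hM using AddSubmonoid.closure_induction with
  | mem M h =>
    obtain ⟨X, Y, hX, hY, rfl⟩ := h
    rw [← mul_kronecker_mul, ← mul_kronecker_mul, Matrix.one_mul, Matrix.mul_one]
    exact kronecker_mem_sepCone hX (hY.mul_mul_conjTranspose_same L)
  | zero => simp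
  | add M N _ _ hM hN =>
    rw [Matrix.mul_add, Matrix.add_mul]
    exact add_mem hM hN

theorem exists_sum_kronecker_of_mem_sepCone {dA dB : ℕ}
    {M : Matrix (Fin dA × Fin dB) (Fin dA × Fin dB) ℂ} (hM : M ∈ sepCone dA dB) :
    ∃ (n : ℕ) (X : Fin n → Matrix (Fin dA) (Fin dA) ℂ) (Y : Fin n → Matrix (Fin dB) (Fin dB) ℂ),
      (∀ j, (X j).PosSemidef) ∧ (∀ j, (Y j).PosSemidef) ∧ M = ∑ j, X j ⊗ₖ Y j := by
  induction hM using AddSubmonoid.closure_induction with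
  | mem M h =>
    obtain ⟨X, Y, hX, hY, rfl⟩ := h
    exact ⟨1, fun _ => X, fun _ => Y, fun _ => hX, fun _ => hY, by simp⟩
  | zero => exact ⟨0, fun _ => 0, fun _ => 0, by simp, by simp, by simp⟩
  | add M N _ _ hM hN =>
    obtain ⟨m, X, Y, hX, hY, rfl⟩ := hM
    obtain ⟨n, X', Y', hX', hY', rfl⟩ := hN
    refine ⟨m + n, Fin.append X X', Fin.append Y Y', ?_, ?_, ?_⟩
    · intro j; refine Fin.addCases (fun i => ?_) (fun i => ?_) j <;> simp [hX, hX']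
    · intro j; refine Fin.addCases (fun i => ?_) (fun i => ?_) j <;> simp [hY, hY']
    · simp [Fin.sum_univ_add]

theorem exists_isDensity_smul {d : ℕ} [NeZero d] {X : Matrix (Fin d) (Fin d) ℂ}
    (hX : X.PosSemidef) : ∃ (t : ℝ) (X' : Matrix (Fin d) (Fin d) ℂ),
      0 ≤ t ∧ IsDensity X' ∧ X = (t : ℂ) • X' := by
  have h0 := hX.trace_nonneg
  obtain ⟨t, ht⟩ : ∃ t : ℝ, X.trace = (t : ℂ) :=
    ⟨X.trace.re, Complex.ext rfl (by simpa using (Complex.le_def.1 h0).2.symm)⟩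
  have ht0 : 0 ≤ t := by rw [ht] at h0; exact_mod_cast h0
  by_cases h : t = 0
  · refine ⟨0, diagonal (Pi.single 0 1), le_rfl, ⟨.diagonal ?_, ?_⟩, ?_⟩
    · exact Pi.single_nonneg.2 zero_le_one
    · simp [trace_diagonal]
    · simpa [hX.trace_eq_zero_iff, h] using ht
  · have hc : (t : ℂ) ≠ 0 := by exact_mod_cast h
    refine ⟨t, (t : ℂ)⁻¹ • X, ht0, ⟨hX.smul ?_, ?_⟩, ?_⟩
    · exact_mod_cast inv_nonneg.2 ht0
    · simp [trace_smul, ht, hc]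
    · simp [smul_smul, hc]

theorem separable_of_mem_sepCone {dA dB : ℕ} [NeZero dA] [NeZero dB]
    {ρ : Matrix (Fin dA × Fin dB) (Fin dA × Fin dB) ℂ} (hρ : ρ ∈ sepCone dA dB)
    (htr : ρ.trace = 1) : Separable ρ := by
  obtain ⟨n, X, Y, hX, hY, rfl⟩ := exists_sum_kronecker_of_mem_sepCone hρ
  choose s X' hs hX' hXs using fun j => exists_isDensity_smul (hX j)
  choose t Y' ht hY' hYt using fun j => exists_isDensity_smul (hY j)
  refine ⟨n, fun j => s j * t j, X', Y', fun j => mul_nonneg (hs j) (ht j), ?_, hX', hY', ?_⟩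
  · rw [trace_sum] at htr
    have : ∀ j, (X j ⊗ₖ Y j).trace = ((s j * t j : ℝ) : ℂ) := fun j => by
      rw [trace_kronecker, hXs j, hYt j, trace_smul, trace_smul, (hX' j).2, (hY' j).2]
      simp
    simp only [this] at htr
    exact_mod_cast htr
  · refine Finset.sum_congr rfl fun j _ => ?_
    rw [hXs j, hYt j, smul_kronecker, kronecker_smul, smul_smul]
    push_cast
    rfl

open scoped Matrix.Norms.L2Operator in
/-- Spectral resolution of a normal matrix. -/
theorem exists_spectral_resolution {n : Type*} [Fintype n] [DecidableEq n] {N : Matrix n n ℂ}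
    (hN : Nᴴ * N = N * Nᴴ) : ∃ (s : Finset ℂ) (P : ℂ → Matrix n n ℂ), (∀ z, (P z).PosSemidef) ∧
      ∑ z ∈ s, P z = 1 ∧ ∑ z ∈ s, z • P z = N ∧ ∑ z ∈ s, (star z * z) • P z = Nᴴ * N := by
  have hn : IsStarNormal N := ⟨hN⟩
  have hfin : (spectrum ℂ N).Finite := Matrix.finite_spectrum N
  have hcont (f : ℂ → ℂ) : ContinuousOn f (spectrum ℂ N) := hfin.continuousOn f
  have key (g : ℂ → ℂ) : ∑ z ∈ hfin.toFinset, g z • cfc (Pi.single z 1) N = cfc g N := by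
    have : ∀ z ∈ hfin.toFinset, g z • cfc (Pi.single z 1) N =
        cfc (fun w => g z • (Pi.single z 1 : ℂ → ℂ) w) N := fun z _ =>
      (cfc_smul (g z) _ N (hcont _)).symm
    rw [Finset.sum_congr rfl this, ← cfc_sum _ N _ fun _ _ => hcont _]
    refine cfc_congr fun w hw => ?_
    simp only [Finset.sum_apply]
    rw [Finset.sum_eq_single w]
    · simp
    · intro b _ hb
      simp [Pi.single_eq_of_ne hb.symm]
    · intro h
      exact absurd (hfin.mem_toFinset.2 hw) h
  refine ⟨hfin.toFinset, fun z => cfc (Pi.single z 1) N, fun z => ?_, ?_, ?_, ?_⟩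
  · have : cfc (Pi.single z 1) N = (cfc (Pi.single z (1 : ℂ)) N)ᴴ * cfc (Pi.single z (1 : ℂ)) N := by
      rw [← star_eq_conjTranspose, ← cfc_star, ← cfc_mul _ _ N (hcont _) (hcont _)]
      refine cfc_congr fun w _ => ?_
      by_cases h : w = z
      · subst h; simp
      · simp [Pi.single_eq_of_ne h]
    beta_reduce
    rw [this]
    exact posSemidef_conjTranspose_mul_self _
  · simpa [cfc_const_one ℂ N] using key fun _ => 1
  · simpa [cfc_id' ℂ N] using key fun z => z
  · refine (key fun z => star z * z).trans ?_
    rw [cfc_mul _ _ N (hcont _) (hcont _), cfc_star_id (ha := hn), cfc_id' ℂ N, star_eq_conjTranspose]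

/-- The matrix on `ℂ² ⊗ ℂᵈ` with blocks `A`, `B`, `Bᴴ`, `C`. -/
def blockMatrix {d : ℕ} (A B C : Matrix (Fin d) (Fin d) ℂ) :
    Matrix (Fin 2 × Fin d) (Fin 2 × Fin d) ℂ :=
  Matrix.of fun p q => (!![A, B; Bᴴ, C] p.1 q.1) p.2 q.2

theorem blockMatrix_mem_of_sub {d : ℕ} {A B C C' : Matrix (Fin d) (Fin d) ℂ}
    (h : blockMatrix A B C' ∈ sepCone 2 d) (hC : (C - C').PosSemidef) :
    blockMatrix A B C ∈ sepCone 2 d := by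
  have hE : (diagonal ![(0 : ℂ), 1]).PosSemidef := by
    refine .diagonal fun i => ?_
    fin_cases i <;> simp
  have : blockMatrix A B C = blockMatrix A B C' + diagonal ![(0 : ℂ), 1] ⊗ₖ (C - C') := by
    ext ⟨i, a⟩ ⟨j, b⟩
    fin_cases i <;> fin_cases j <;> simp [blockMatrix, kroneckerMap_apply]
  rw [this]
  exact add_mem h (kronecker_mem_sepCone hE hC)

theorem blockMatrix_mem_of_normal {d : ℕ} {n : Type*} [Fintype n] [DecidableEq n]
    {N : Matrix n n ℂ} (hN : Nᴴ * N = N * Nᴴ) (V : Matrix (Fin d) n ℂ) :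
    blockMatrix (V * Vᴴ) (V * N * Vᴴ) (V * (Nᴴ * N) * Vᴴ) ∈ sepCone 2 d := by
  obtain ⟨s, P, hP, h1, h2, h3⟩ := exists_spectral_resolution hN
  have hE (z : ℂ) : (!![1, z; star z, star z * z]).PosSemidef := by
    convert posSemidef_vecMulVec_self_star ![1, star z] using 1
    ext i j
    fin_cases i <;> fin_cases j <;> simp [vecMulVec_apply]
  have e1 : V * Vᴴ = ∑ z ∈ s, V * P z * Vᴴ := by
    rw [← Matrix.sum_mul, ← Matrix.mul_sum, h1, Matrix.mul_one]
  have e2 : V * N * Vᴴ = ∑ z ∈ s, z • (V * P z * Vᴴ) := by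
    simp only [← h2, Matrix.sum_mul, Matrix.mul_sum, Matrix.mul_smul, Matrix.smul_mul]
  have e3 : V * (Nᴴ * N) * Vᴴ = ∑ z ∈ s, (star z * z) • (V * P z * Vᴴ) := by
    simp only [← h3, Matrix.sum_mul, Matrix.mul_sum, Matrix.mul_smul, Matrix.smul_mul]
  have e4 : (V * N * Vᴴ)ᴴ = ∑ z ∈ s, star z • (V * P z * Vᴴ) := by
    simp only [e2, conjTranspose_sum, conjTranspose_smul, conjTranspose_mul,
      conjTranspose_conjTranspose, (hP _).1.eq, Matrix.mul_assoc]
  have : blockMatrix (V * Vᴴ) (V * N * Vᴴ) (V * (Nᴴ * N) * Vᴴ) =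
      ∑ z ∈ s, !![1, z; star z, star z * z] ⊗ₖ (V * P z * Vᴴ) := by
    ext ⟨i, a⟩ ⟨j, b⟩
    simp only [blockMatrix, e4, of_apply, Matrix.sum_apply]
    rw [e1, e2, e3]
    fin_cases i <;> fin_cases j <;> simp [kroneckerMap_apply, Matrix.sum_apply]
  rw [this]
  exact sum_mem fun z _ =>
    kronecker_mem_sepCone (hE z) ((hP z).mul_mul_conjTranspose_same V)

theorem conj_blockMatrix {d : ℕ} (A B C L : Matrix (Fin d) (Fin d) ℂ) :
    ((1 : Matrix (Fin 2) (Fin 2) ℂ) ⊗ₖ L) * blockMatrix A B C *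
      ((1 : Matrix (Fin 2) (Fin 2) ℂ) ⊗ₖ Lᴴ) =
      blockMatrix (L * A * Lᴴ) (L * B * Lᴴ) (L * C * Lᴴ) := by
  have h : (L * B * Lᴴ)ᴴ = L * Bᴴ * Lᴴ := by simp [Matrix.mul_assoc]
  ext ⟨i, a⟩ ⟨j, b⟩
  simp only [blockMatrix, h]
  fin_cases i <;> fin_cases j <;>
    simp [Matrix.mul_apply, Fintype.sum_prod_type, kroneckerMap_apply]

/-- A positive semidefinite block matrix with positive definite corner that stays positive
semidefinite when the off-diagonal blocks are swapped reduces to the case of corner `1`. -/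
theorem blockMatrix_mem_of_posDef {d : ℕ}
    (hone : ∀ B C : Matrix (Fin d) (Fin d) ℂ, (C - Bᴴ * B).PosSemidef → (C - B * Bᴴ).PosSemidef →
      blockMatrix 1 B C ∈ sepCone 2 d)
    {A B C : Matrix (Fin d) (Fin d) ℂ} (hA : A.PosDef) (h1 : (fromBlocks A B Bᴴ C).PosSemidef)
    (h2 : (fromBlocks A Bᴴ B C).PosSemidef) : blockMatrix A B C ∈ sepCone 2 d := by
  obtain ⟨L, hL⟩ : ∃ L : Matrix (Fin d) (Fin d) ℂ, A = L * Lᴴ := by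
    open scoped MatrixOrder in
    obtain ⟨a, ha⟩ := CStarAlgebra.nonneg_iff_eq_star_mul_self.mp hA.posSemidef.nonneg
    exact ⟨aᴴ, by simpa [star_eq_conjTranspose] using ha⟩
  have hLu : IsUnit L.det := by
    have := (isUnit_iff_isUnit_det _).1 hA.isUnit
    rw [hL, det_mul] at this
    exact isUnit_of_mul_isUnit_left this
  have hLu' : IsUnit Lᴴ.det := by rw [det_conjTranspose]; exact hLu.star
  have hinv : A⁻¹ = (L⁻¹)ᴴ * L⁻¹ := by rw [hL, Matrix.mul_inv_rev, conjTranspose_nonsing_inv]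
  have : Invertible A := hA.isUnit.invertible
  have s1 := (PosDef.fromBlocks₁₁ B C hA).1 h1
  have s2 := (PosDef.fromBlocks₁₁ Bᴴ C hA).1 (by simpa using h2)
  have c1 := s1.mul_mul_conjTranspose_same L⁻¹
  have c2 := s2.mul_mul_conjTranspose_same L⁻¹
  rw [hinv] at c1 c2
  have := conj_mem_sepCone (hone (L⁻¹ * B * (L⁻¹)ᴴ) (L⁻¹ * C * (L⁻¹)ᴴ)
    (by simpa [Matrix.mul_sub, Matrix.sub_mul, Matrix.mul_assoc] using c1)
    (by simpa [Matrix.mul_sub, Matrix.sub_mul, Matrix.mul_assoc] using c2)) L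
  have canc (X : Matrix (Fin d) (Fin d) ℂ) : L * (L⁻¹ * X * (L⁻¹)ᴴ) * Lᴴ = X := by
    rw [conjTranspose_nonsing_inv, Matrix.mul_assoc, Matrix.mul_assoc, Matrix.mul_assoc,
      nonsing_inv_mul _ hLu', Matrix.mul_one, ← Matrix.mul_assoc, mul_nonsing_inv _ hLu,
      Matrix.one_mul]
  rw [conj_blockMatrix, canc, canc, Matrix.mul_one, ← hL] at this
  exact this

theorem Matrix.PosSemidef.conjTranspose_mulVec_eq_zero_of_fromBlocks {m n : Type*} [Fintype m]
    [Fintype n] {A : Matrix m m ℂ} {B : Matrix m n ℂ} {C : Matrix n n ℂ}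
    (h : (fromBlocks A B Bᴴ C).PosSemidef) {v : m → ℂ} (hv : A *ᵥ v = 0) : Bᴴ *ᵥ v = 0 := by
  have h0 : star (Sum.elim v 0) ⬝ᵥ (fromBlocks A B Bᴴ C *ᵥ Sum.elim v 0) = 0 := by
    simp [fromBlocks_mulVec, hv, dotProduct, Fintype.sum_sum_type]
  have h1 := (h.dotProduct_mulVec_zero_iff _).1 h0
  ext i
  simpa [fromBlocks_mulVec] using congrFun h1 (Sum.inr i)

theorem exists_eq_smul_vecMulVec {w : Fin 2 → ℂ} (hw : w ≠ 0) {X : Matrix (Fin 2) (Fin 2) ℂ}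
    (h1 : X *ᵥ w = 0) (h2 : Xᴴ *ᵥ w = 0) :
    ∃ c : ℂ, X = c • vecMulVec ![star (w 1), -star (w 0)] (star ![star (w 1), -star (w 0)]) := by
  have a0 := congrFun h1 0
  have a1 := congrFun h1 1
  have b0 := congrArg star (congrFun h2 0)
  have b1 := congrArg star (congrFun h2 1)
  simp [mulVec, dotProduct, Fin.sum_univ_two] at a0 a1 b0 b1
  by_cases h0 : w 0 = 0
  · have hw1 : w 1 ≠ 0 := fun h => hw (by ext i; fin_cases i <;> simp [h0, h])
    have hs : starRingEnd ℂ (w 1) ≠ 0 := by simpa using hw1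
    refine ⟨X 0 0 / (w 1 * star (w 1)), ?_⟩
    simp [h0, hw1] at a0 a1 b0 b1
    ext i j
    simp only [Matrix.smul_apply, vecMulVec_apply, Pi.star_apply]
    fin_cases i <;> fin_cases j <;> simp [h0, a0, a1, b0]
    field_simp
  · have hs : star (w 0) ≠ 0 := by simpa using h0
    refine ⟨X 1 1 / (w 0 * star (w 0)), ?_⟩
    simp only [Complex.star_def] at hs
    ext i j
    simp only [Matrix.smul_apply, vecMulVec_apply, Pi.star_apply]
    fin_cases i <;> fin_cases j <;> simp <;> field_simp
    · linear_combination (starRingEnd ℂ) (w 0) * a0 - w 1 * b1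
    · linear_combination b1
    · linear_combination a1

theorem blockMatrix_mem_of_not_posDef {A B C : Matrix (Fin 2) (Fin 2) ℂ} (hA : ¬ A.PosDef)
    (h1 : (fromBlocks A B Bᴴ C).PosSemidef) (h2 : (fromBlocks A Bᴴ B C).PosSemidef) :
    blockMatrix A B C ∈ sepCone 2 2 := by
  have hAp : A.PosSemidef := h1.submatrix Sum.inl
  have hCp : C.PosSemidef := h1.submatrix Sum.inr
  have hdet : A.det = 0 := by
    by_contra h
    exact hA (hAp.posDef_iff_det_ne_zero.2 h)
  obtain ⟨w, hw, hAw⟩ := exists_mulVec_eq_zero_iff.2 hdet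
  have hB1 : Bᴴ *ᵥ w = 0 := h1.conjTranspose_mulVec_eq_zero_of_fromBlocks hAw
  have hB2 : B *ᵥ w = 0 := by
    have := PosSemidef.conjTranspose_mulVec_eq_zero_of_fromBlocks (B := Bᴴ) (by simpa using h2) hAw
    simpa using this
  obtain ⟨α, hα⟩ := exists_eq_smul_vecMulVec hw hAw (by rwa [hAp.1.eq])
  obtain ⟨β, hβ⟩ := exists_eq_smul_vecMulVec hw hB2 hB1
  set e : Fin 2 → ℂ := ![star (w 1), -star (w 0)] with he
  have he0 : e ≠ 0 := fun h => hw (by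
    have h0 := congrFun h 0
    have h1 := congrFun h 1
    simp [he] at h0 h1
    ext i; fin_cases i <;> simp [h0, h1])
  have hE : (vecMulVec e (star e)).PosSemidef := posSemidef_vecMulVec_self_star e
  have hg : 0 < star e ⬝ᵥ e := dotProduct_star_self_pos_iff.2 he0
  have hEE : vecMulVec e (star e) * vecMulVec e (star e) =
      (star e ⬝ᵥ e) • vecMulVec e (star e) := by
    rw [vecMulVec_mul_vecMulVec, vecMulVec_smul]
  set E := vecMulVec e (star e)
  set g := star e ⬝ᵥ e
  have hα0 : 0 ≤ α := by
    have := hAp.trace_nonneg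
    rw [hα, trace_smul, trace_vecMulVec, dotProduct_comm] at this
    have h := mul_nonneg this (inv_nonneg.2 hg.le)
    rwa [smul_eq_mul, mul_assoc, mul_inv_cancel₀ hg.ne', mul_one] at h
  rcases hα0.eq_or_lt with h0 | hpos
  · have hA0 : A = 0 := by rw [hα, ← h0, zero_smul]
    have hB0 : B = 0 := by
      have : Bᴴ = 0 := by
        refine ext_of_mulVec_single fun i => ?_
        exact (h1.conjTranspose_mulVec_eq_zero_of_fromBlocks (by rw [hA0, zero_mulVec])).trans
          (zero_mulVec _).symm
      simpa using this
    refine blockMatrix_mem_of_sub (C' := 0) ?_ (by simpa using hCp)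
    have : blockMatrix A B 0 = 0 := by
      ext ⟨i, a⟩ ⟨j, b⟩
      fin_cases i <;> fin_cases j <;> simp [blockMatrix, hA0, hB0]
    rw [this]
    exact zero_mem _
  · have hαs : star α = α := (IsSelfAdjoint.of_nonneg hα0).star_eq
    have hgs : star g = g := (IsSelfAdjoint.of_nonneg hg.le).star_eq
    have hEs : Eᴴ = E := hE.1.eq
    refine blockMatrix_mem_of_sub (C' := (star β * β / α) • E) ?_ ?_
    · have hQ : (!![α, β; star β, star β * β / α]).PosSemidef := by
        have := (posSemidef_vecMulVec_self_star ![α, star β]).smul (inv_nonneg.2 hα0)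
        convert this using 1
        simp only [Complex.star_def] at hαs
        have hα' := hpos.ne'
        ext i j
        simp only [Matrix.smul_apply, vecMulVec_apply, Pi.star_apply]
        fin_cases i <;> fin_cases j <;> simp [hαs] <;> field_simp
      have : blockMatrix A B ((star β * β / α) • E) =
          !![α, β; star β, star β * β / α] ⊗ₖ E := by
        ext ⟨i, a⟩ ⟨j, b⟩
        rw [hα, hβ]
        fin_cases i <;> fin_cases j <;>
          simp [blockMatrix, kroneckerMap_apply, -Complex.star_def, hEs]
      rw [this]
      exact kronecker_mem_sepCone hQ hE
    · have := h1.conjTranspose_mul_mul_same (fromRows (-(β / (α * g)) • E) 1)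
      rw [conjTranspose_fromRows_eq_fromCols_conjTranspose, Matrix.mul_assoc,
        fromBlocks_mul_fromRows, fromCols_mul_fromRows, hα, hβ] at this
      convert this using 1
      simp only [conjTranspose_smul, hEs, Matrix.smul_mul, Matrix.mul_smul, hEE, smul_smul,
        Matrix.mul_one, conjTranspose_one, Matrix.one_mul, Matrix.mul_add, star_neg, star_div₀,
        star_mul', hαs, hgs]
      have hα' := hpos.ne'
      have hg' := hg.ne'
      ext i j
      simp
      field_simp
      ring

theorem exists_eq_vecMulVec_self_star {X : Matrix (Fin 2) (Fin 2) ℂ} (hX : X.IsHermitian)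
    (hdet : X.det = 0) (htr : 0 ≤ X.trace) : ∃ x, X = vecMulVec x (star x) := by
  obtain ⟨a, ha⟩ : ∃ a : ℝ, X 0 0 = a := ⟨_, (hX.coe_re_apply_self 0).symm⟩
  obtain ⟨c, hc⟩ : ∃ c : ℝ, X 1 1 = c := ⟨_, (hX.coe_re_apply_self 1).symm⟩
  have hb : X 1 0 = star (X 0 1) := (hX.apply 1 0).symm
  rw [det_fin_two, ha, hc, hb, Complex.star_def, Complex.mul_conj] at hdet
  rw [trace_fin_two, ha, hc] at htr
  have hdet' : a * c = Complex.normSq (X 0 1) := by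
    have : ((a * c - Complex.normSq (X 0 1) : ℝ) : ℂ) = 0 := by push_cast; exact hdet
    have := Complex.ofReal_eq_zero.1 this
    linarith
  have htr' : 0 ≤ a + c := by exact_mod_cast htr
  have hn := Complex.normSq_nonneg (X 0 1)
  have ha0 : 0 ≤ a := by
    by_contra h
    push Not at h
    nlinarith [mul_pos_of_neg_of_neg h h]
  rcases ha0.eq_or_lt with h0 | hpos
  · have hb0 : X 0 1 = 0 := by
      rw [← h0, zero_mul] at hdet'
      exact Complex.normSq_eq_zero.1 hdet'.symm
    have hc0 : 0 ≤ c := by linarith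
    refine ⟨![0, (√c : ℝ)], ?_⟩
    have : ((√c : ℝ) : ℂ) * ((√c : ℝ) : ℂ) = c := by exact_mod_cast Real.mul_self_sqrt hc0
    ext i j
    simp only [vecMulVec_apply, Pi.star_apply]
    fin_cases i <;> fin_cases j <;> simp [ha, hc, hb, hb0, ← h0, this]
  · have hs : ((√a : ℝ) : ℂ) * ((√a : ℝ) : ℂ) = a := by exact_mod_cast Real.mul_self_sqrt hpos.le
    have hs0 : ((√a : ℝ) : ℂ) ≠ 0 := by exact_mod_cast (Real.sqrt_pos.2 hpos).ne'
    refine ⟨![(√a : ℝ), star (X 0 1) / (√a : ℝ)], ?_⟩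
    have hd : (a : ℂ) * c = X 0 1 * starRingEnd ℂ (X 0 1) := by
      rw [Complex.mul_conj]; exact_mod_cast hdet'
    ext i j
    simp only [vecMulVec_apply, Pi.star_apply]
    fin_cases i <;> fin_cases j <;> simp [ha, hc, hb, hs]
    · field_simp
    · field_simp
    · field_simp
      rw [sq, hs]
      linear_combination hd

theorem det_re_neg_of_trace_eq_zero {D : Matrix (Fin 2) (Fin 2) ℂ} (hD : D.IsHermitian)
    (htr : D.trace = 0) (h0 : D ≠ 0) : ∃ d : ℝ, d < 0 ∧ D.det = d := by
  obtain ⟨a, ha⟩ : ∃ a : ℝ, D 0 0 = a := ⟨_, (hD.coe_re_apply_self 0).symm⟩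
  have hb : D 1 0 = star (D 0 1) := (hD.apply 1 0).symm
  have hc : D 1 1 = -a := by
    rw [trace_fin_two, ha] at htr
    linear_combination htr
  refine ⟨-(a ^ 2 + Complex.normSq (D 0 1)), ?_, ?_⟩
  · have h1 := sq_nonneg a
    have h2 := Complex.normSq_nonneg (D 0 1)
    by_contra h
    have ha0 : a = 0 := by
      have : a ^ 2 = 0 := by linarith
      simpa using this
    have hb0 : D 0 1 = 0 := Complex.normSq_eq_zero.1 (by linarith)
    refine h0 ?_
    ext i j
    fin_cases i <;> fin_cases j <;> simp [ha, hb, hc, ha0, hb0]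
  · rw [det_fin_two, ha, hb, hc, Complex.star_def, Complex.mul_conj]
    push_cast
    ring

theorem one_sub_vecMulVec_posSemidef {w : Fin 2 → ℂ} (hw : star w ⬝ᵥ w ≤ 1) :
    (1 - vecMulVec w (star w)).PosSemidef := by
  have h : 1 - vecMulVec w (star w) = (1 - star w ⬝ᵥ w) • (1 : Matrix (Fin 2) (Fin 2) ℂ) +
      vecMulVec ![star (w 1), -star (w 0)] (star ![star (w 1), -star (w 0)]) := by
    ext i j
    simp only [vecMulVec_apply, Pi.star_apply, Matrix.sub_apply, Matrix.add_apply,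
      Matrix.smul_apply]
    fin_cases i <;> fin_cases j <;> simp [dotProduct, Fin.sum_univ_two] <;> ring
  rw [h]
  exact (PosSemidef.one.smul (sub_nonneg.2 hw)).add (posSemidef_vecMulVec_self_star _)

theorem exists_ne_zero_re_dotProduct_mulVec_le {T : Matrix (Fin 2) (Fin 2) ℂ}
    (hT : T.IsHermitian) {d : ℝ} (h : (T - (d : ℂ) • 1).det ≤ 0) :
    ∃ u : Fin 2 → ℂ, ∃ τ r : ℝ, u ≠ 0 ∧ star u ⬝ᵥ u = r ∧ star u ⬝ᵥ (T *ᵥ u) = τ ∧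
      τ ≤ d * r := by
  have hH : (T - (d : ℂ) • 1).IsHermitian := by
    refine hT.sub ?_
    simp [IsHermitian, conjTranspose_smul]
  have hnp : ¬ (T - (d : ℂ) • 1).PosDef := fun hp => (hp.det_pos.trans_le h).false
  have hex : ∃ u : Fin 2 → ℂ, u ≠ 0 ∧ ¬ 0 < star u ⬝ᵥ ((T - (d : ℂ) • 1) *ᵥ u) := by
    by_contra hc
    push Not at hc
    exact hnp (.of_dotProduct_mulVec_pos hH fun x hx => hc x hx)
  obtain ⟨u, hu, hneg⟩ := hex
  have hτ : star u ⬝ᵥ (T *ᵥ u) = ((star u ⬝ᵥ (T *ᵥ u)).re : ℂ) :=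
    Complex.ext rfl (by simpa using hT.im_star_dotProduct_mulVec_self u)
  have hr : star u ⬝ᵥ u = ((star u ⬝ᵥ u).re : ℂ) :=
    Complex.ext rfl (by simpa using (isHermitian_one (α := ℂ)).im_star_dotProduct_mulVec_self u)
  refine ⟨u, _, _, hu, hr, hτ, ?_⟩
  rw [sub_mulVec, dotProduct_sub, smul_mulVec, one_mulVec, dotProduct_smul, hτ, hr,
    smul_eq_mul] at hneg
  by_contra hlt
  push Not at hlt
  exact hneg (by exact_mod_cast sub_pos.2 hlt)

theorem exists_rank_one_difference {P D : Matrix (Fin 2) (Fin 2) ℂ} (hP : P.PosSemidef)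
    (hD : D.IsHermitian) (htr : D.trace = 0) (h0 : D ≠ 0) (hPD : (P + D).PosSemidef) :
    ∃ x y : Fin 2 → ℂ, D = vecMulVec x (star x) - vecMulVec y (star y) ∧
      (P - vecMulVec y (star y)).PosSemidef := by
  obtain ⟨L, hL⟩ : ∃ L : Matrix (Fin 2) (Fin 2) ℂ, P = L * Lᴴ := by
    open scoped MatrixOrder in
    obtain ⟨a, ha⟩ := CStarAlgebra.nonneg_iff_eq_star_mul_self.mp hP.nonneg
    exact ⟨aᴴ, by simpa [star_eq_conjTranspose] using ha⟩
  obtain ⟨d, hd0, hd⟩ := det_re_neg_of_trace_eq_zero hD htr h0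
  have hT : (Lᴴ * D * L).IsHermitian := isHermitian_conjTranspose_mul_mul L hD
  have hD11 : D 1 1 = -D 0 0 := by
    rw [trace_fin_two] at htr
    linear_combination htr
  have hdet : (Lᴴ * D * L - (d : ℂ) • 1).det ≤ 0 := by
    have e1 : (Lᴴ * D * L).det = D.det * P.det := by
      rw [hL, det_mul, det_mul, det_mul]; ring
    have e2 : (Lᴴ * D * L).trace = (D * P).trace := by
      rw [hL, ← Matrix.mul_assoc, trace_mul_comm (D * L), Matrix.mul_assoc]
    have e3 : (P + D).det = P.det + D.det - (D * P).trace := by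
      simp only [det_fin_two, trace_fin_two, Matrix.mul_apply, Fin.sum_univ_two, Matrix.add_apply,
        hD11]
      ring
    have e4 : (Lᴴ * D * L - (d : ℂ) • 1).det =
        (Lᴴ * D * L).det - d * (Lᴴ * D * L).trace + d ^ 2 := by
      simp only [det_fin_two, trace_fin_two, Matrix.sub_apply, Matrix.smul_apply, one_apply]
      simp
      ring
    have e5 : (Lᴴ * D * L - (d : ℂ) • 1).det = d * (P + D).det := by
      rw [e4, e1, e2, e3, hd]; ring
    rw [e5]
    exact mul_nonpos_of_nonpos_of_nonneg (by exact_mod_cast hd0.le) hPD.det_nonneg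
  obtain ⟨u, τ, r, hu, hr, hτ, hle⟩ := exists_ne_zero_re_dotProduct_mulVec_le hT hdet
  have hr0 : 0 < r := by
    have := dotProduct_star_self_pos_iff.2 hu
    rw [hr] at this
    exact_mod_cast this
  have hτ0 : τ < 0 := hle.trans_lt (mul_neg_of_neg_of_pos hd0 hr0)
  have hk : 0 ≤ d / τ := div_nonneg_of_nonpos hd0.le hτ0.le
  obtain ⟨k, hks, hk2⟩ : ∃ k : ℂ, star k = k ∧ k * k = (d / τ : ℝ) :=
    ⟨(√(d / τ) : ℝ), by simp, by exact_mod_cast Real.mul_self_sqrt hk⟩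
  have hw : star (k • u) ⬝ᵥ (k • u) ≤ 1 := by
    rw [star_smul, hks, smul_dotProduct, dotProduct_smul, smul_smul, hk2, hr, smul_eq_mul]
    have : d / τ * r ≤ 1 := by
      rw [div_mul_eq_mul_div, div_le_one_of_neg hτ0]
      exact hle
    exact_mod_cast this
  have hyD : star (L *ᵥ (k • u)) ⬝ᵥ (D *ᵥ (L *ᵥ (k • u))) = d := by
    rw [star_mulVec, ← dotProduct_mulVec, mulVec_mulVec, mulVec_mulVec,
      star_smul, hks, mulVec_smul, smul_dotProduct, dotProduct_smul, smul_smul, hk2, hτ,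
      smul_eq_mul, ← Complex.ofReal_mul, div_mul_cancel₀ _ hτ0.ne]
  have hPy : (P - vecMulVec (L *ᵥ (k • u)) (star (L *ᵥ (k • u)))).PosSemidef := by
    have := (one_sub_vecMulVec_posSemidef hw).mul_mul_conjTranspose_same L
    rwa [Matrix.mul_sub, Matrix.sub_mul, Matrix.mul_one, ← hL, mul_vecMulVec, vecMulVec_mul,
      ← star_mulVec] at this
  set y := L *ᵥ (k • u)
  have hy := posSemidef_vecMulVec_self_star y
  obtain ⟨x, hx⟩ := exists_eq_vecMulVec_self_star (X := D + vecMulVec y (star y))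
    (hD.add hy.1) (by
      rw [← sub_eq_zero] at hyD
      rw [det_fin_two] at hd ⊢
      simp only [dotProduct, mulVec, Fin.sum_univ_two, Pi.star_apply, Matrix.add_apply,
        vecMulVec_apply, hD11] at hyD hd ⊢
      linear_combination hd - hyD)
    (by rw [trace_add, htr, zero_add]; exact hy.trace_nonneg)
  exact ⟨x, y, by rw [← hx]; abel, hPy⟩

open scoped ComplexConjugate in
/-- The corner entry of a normal `3 × 3` matrix with prescribed first row and column blocks. -/
theorem exists_normal_corner {B : Matrix (Fin 2) (Fin 2) ℂ} {x y : Fin 2 → ℂ}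
    (h : Bᴴ * B - B * Bᴴ = vecMulVec x (star x) - vecMulVec y (star y))
    (h0 : (vecMulVec x (star x) - vecMulVec y (star y)).det ≠ 0) :
    ∃ z : ℂ, Bᴴ *ᵥ x - B *ᵥ y = star z • x - z • y := by
  have E00 := congrFun₂ h 0 0
  have E01 := congrFun₂ h 0 1
  have E10 := congrFun₂ h 1 0
  have E11 := congrFun₂ h 1 1
  simp only [Matrix.sub_apply, Matrix.mul_apply, Fin.sum_univ_two, conjTranspose_apply,
    vecMulVec_apply, Pi.star_apply, Complex.star_def] at E00 E01 E10 E11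
  set Δ := x 0 * y 1 - x 1 * y 0 with hΔ
  have hΔs : conj Δ = conj (x 0) * conj (y 1) - conj (x 1) * conj (y 0) := by simp [hΔ]
  have hΔΔ : Δ * conj Δ ≠ 0 := by
    intro hz
    refine h0 ?_
    simp only [det_fin_two, Matrix.sub_apply, vecMulVec_apply, Pi.star_apply, Complex.star_def]
    rw [hΔs, hΔ] at hz
    linear_combination -hz
  have hΔ0 : Δ ≠ 0 := left_ne_zero_of_mul hΔΔ
  have hnorm : x 0 * conj (x 0) + x 1 * conj (x 1) = y 0 * conj (y 0) + y 1 * conj (y 1) := by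
    linear_combination -E00 - E11
  have hquad : conj (x 0) * (B 0 0 * x 0 + B 0 1 * x 1) + conj (x 1) * (B 1 0 * x 0 + B 1 1 * x 1) =
      conj (y 0) * (B 0 0 * y 0 + B 0 1 * y 1) + conj (y 1) * (B 1 0 * y 0 + B 1 1 * y 1) := by
    linear_combination -B 0 0 * E00 - B 0 1 * E10 - B 1 0 * E01 - B 1 1 * E11
  have hquad' := congrArg conj hquad
  simp only [map_add, map_mul, Complex.conj_conj] at hquad'
  set v0 := conj (B 0 0) * x 0 + conj (B 1 0) * x 1 - (B 0 0 * y 0 + B 0 1 * y 1) with hv0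
  set v1 := conj (B 0 1) * x 0 + conj (B 1 1) * x 1 - (B 1 0 * y 0 + B 1 1 * y 1) with hv1
  have hv : conj (x 0) * v0 + conj (x 1) * v1 + y 0 * conj v0 + y 1 * conj v1 = 0 := by
    simp only [hv0, hv1, map_add, map_mul, map_sub, Complex.conj_conj]
    linear_combination hquad'
  obtain ⟨α, hα⟩ : ∃ α, α = (v0 * y 1 - v1 * y 0) / Δ := ⟨_, rfl⟩
  obtain ⟨β, hβ⟩ : ∃ β, β = (x 0 * v1 - x 1 * v0) / Δ := ⟨_, rfl⟩
  have w0 : v0 = α * x 0 + β * y 0 := by rw [hα, hβ]; field_simp; rw [hΔ]; ring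
  have w1 : v1 = α * x 1 + β * y 1 := by rw [hα, hβ]; field_simp; rw [hΔ]; ring
  have hs : α + conj β = 0 := by
    rw [w0, w1] at hv
    simp only [map_add, map_mul] at hv
    have k1 : (α + conj β) * (x 0 * conj (x 0) + x 1 * conj (x 1)) +
        (conj α + β) * (conj (x 0) * y 0 + conj (x 1) * y 1) = 0 := by
      linear_combination hv + conj β * hnorm
    have k2 := congrArg conj k1
    simp only [map_add, map_mul, Complex.conj_conj, map_zero] at k2
    have k3 : (α + conj β) * (Δ * conj Δ) = 0 := by
      rw [hΔs, hΔ]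
      linear_combination (x 0 * conj (x 0) + x 1 * conj (x 1)) * k1 -
        (conj (x 0) * y 0 + conj (x 1) * y 1) * k2 -
        (α + conj β) * (x 0 * conj (x 0) + x 1 * conj (x 1)) * hnorm
    exact (mul_eq_zero.1 k3).resolve_right hΔΔ
  have hs' : conj β = -α := by linear_combination hs
  refine ⟨-β, ?_⟩
  ext i
  fin_cases i
  · simp only [Fin.zero_eta, Pi.sub_apply, Pi.smul_apply, smul_eq_mul, mulVec, dotProduct,
      Fin.sum_univ_two, conjTranspose_apply, Complex.star_def, map_neg, hs']
    linear_combination w0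
  · simp only [Fin.mk_one, Pi.sub_apply, Pi.smul_apply, smul_eq_mul, mulVec, dotProduct,
      Fin.sum_univ_two, conjTranspose_apply, Complex.star_def, map_neg, hs']
    linear_combination w1

theorem blockMatrix_one_mem {B C : Matrix (Fin 2) (Fin 2) ℂ} (h1 : (C - Bᴴ * B).PosSemidef)
    (h2 : (C - B * Bᴴ).PosSemidef) : blockMatrix 1 B C ∈ sepCone 2 2 := by
  by_cases hN : Bᴴ * B = B * Bᴴ
  · have := blockMatrix_mem_of_normal hN (1 : Matrix (Fin 2) (Fin 2) ℂ)
    simp only [Matrix.one_mul, conjTranspose_one, Matrix.mul_one] at this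
    exact blockMatrix_mem_of_sub this h1
  · have hD : (Bᴴ * B - B * Bᴴ).IsHermitian :=
      (isHermitian_conjTranspose_mul_self B).sub (isHermitian_mul_conjTranspose_self B)
    have htr : (Bᴴ * B - B * Bᴴ).trace = 0 := by rw [trace_sub, trace_mul_comm, sub_self]
    have hD0 : Bᴴ * B - B * Bᴴ ≠ 0 := sub_ne_zero.2 hN
    obtain ⟨x, y, hxy, hP⟩ := exists_rank_one_difference h1 hD htr hD0 (by simpa using h2)
    obtain ⟨d, hd0, hd⟩ := det_re_neg_of_trace_eq_zero hD htr hD0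
    obtain ⟨z, hz⟩ := exists_normal_corner hxy (by
      rw [← hxy, hd]; exact_mod_cast hd0.ne)
    have hnorm : star x ⬝ᵥ x = star y ⬝ᵥ y := by
      rw [hxy, trace_sub, trace_vecMulVec, trace_vecMulVec, sub_eq_zero] at htr
      rw [dotProduct_comm, htr, dotProduct_comm]
    have key : (fromBlocks B (replicateCol Unit x) (replicateRow Unit (star y))
          (diagonal fun _ => z))ᴴ *
        fromBlocks B (replicateCol Unit x) (replicateRow Unit (star y)) (diagonal fun _ => z) =
        fromBlocks B (replicateCol Unit x) (replicateRow Unit (star y)) (diagonal fun _ => z) *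
        (fromBlocks B (replicateCol Unit x) (replicateRow Unit (star y))
          (diagonal fun _ => z))ᴴ := by
      have hz' (i : Fin 2) := congrFun hz i
      rw [fromBlocks_conjTranspose, fromBlocks_multiply, fromBlocks_multiply, fromBlocks_inj]
      have htl := fun i j => congrFun₂ hxy i j
      simp only [Matrix.sub_apply, Matrix.mul_apply, Fin.sum_univ_two, conjTranspose_apply,
        vecMulVec_apply, Pi.star_apply, Pi.sub_apply, Pi.smul_apply, smul_eq_mul, mulVec,
        dotProduct, Complex.star_def] at htl hz' hnorm
      refine ⟨?_, ?_, ?_, ?_⟩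
      · ext i j
        simp [Matrix.mul_apply]
        linear_combination htl i j
      · ext i j
        simp [Matrix.mul_apply]
        linear_combination hz' i
      · ext i j
        have := congrArg (starRingEnd ℂ) (hz' j)
        simp at this
        simp [Matrix.mul_apply]
        linear_combination this
      · ext i j
        simp [Matrix.mul_apply]
        linear_combination hnorm
    have hmem := blockMatrix_mem_of_normal key (fromCols (1 : Matrix (Fin 2) (Fin 2) ℂ) 0)
    rw [fromBlocks_conjTranspose, fromBlocks_multiply, fromCols_mul_fromBlocks,
      fromCols_mul_fromBlocks, conjTranspose_fromCols_eq_fromRows_conjTranspose,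
      fromCols_mul_fromRows, fromCols_mul_fromRows, fromCols_mul_fromRows] at hmem
    simp only [Matrix.one_mul, conjTranspose_one, Matrix.mul_one, conjTranspose_zero,
      Matrix.mul_zero, Matrix.zero_mul, add_zero] at hmem
    refine blockMatrix_mem_of_sub hmem ?_
    have : (replicateRow Unit (star y))ᴴ * replicateRow Unit (star y) = vecMulVec y (star y) := by
      ext i j
      simp [Matrix.mul_apply, vecMulVec_apply]
    rw [this, ← sub_sub]
    exact hP

theorem mem_sepCone_of_partialTransposeB {ρ : Matrix (Fin 2 × Fin 2) (Fin 2 × Fin 2) ℂ}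
    (hρ : ρ.PosSemidef) (hT : (partialTransposeB ρ).PosSemidef) : ρ ∈ sepCone 2 2 := by
  obtain ⟨A, hA⟩ : ∃ A : Matrix (Fin 2) (Fin 2) ℂ, A = of fun a b => ρ (0, a) (0, b) := ⟨_, rfl⟩
  obtain ⟨B, hB⟩ : ∃ B : Matrix (Fin 2) (Fin 2) ℂ, B = of fun a b => ρ (0, a) (1, b) := ⟨_, rfl⟩
  obtain ⟨C, hC⟩ : ∃ C : Matrix (Fin 2) (Fin 2) ℂ, C = of fun a b => ρ (1, a) (1, b) := ⟨_, rfl⟩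
  have hBs (a b : Fin 2) : ρ (1, a) (0, b) = Bᴴ a b := by
    rw [hB, conjTranspose_apply, of_apply, hρ.1.apply]
  have hblock : ρ = blockMatrix A B C := by
    ext ⟨i, a⟩ ⟨j, b⟩
    fin_cases i <;> fin_cases j <;> simp [blockMatrix, hA, hC, hBs]
    simp [hB]
  have h1 : (fromBlocks A B Bᴴ C).PosSemidef := by
    convert hρ.submatrix (Sum.elim (fun a => ((0 : Fin 2), a)) fun a => ((1 : Fin 2), a)) using 1
    ext (i | i) (j | j) <;> simp [hA, hC, hBs]
    simp [hB]
  have h2 : (fromBlocks A Bᴴ B C).PosSemidef := by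
    have e : fromBlocks A Bᴴ B C = (partialTransposeB ρ)ᵀ.submatrix
        (Sum.elim (fun a => ((0 : Fin 2), a)) fun a => ((1 : Fin 2), a))
        (Sum.elim (fun a => ((0 : Fin 2), a)) fun a => ((1 : Fin 2), a)) := by
      ext (i | i) (j | j) <;> simp [hA, hC, hBs, partialTransposeB]
      simp [hB]
    rw [e]
    exact hT.transpose.submatrix _
  rw [hblock]
  by_cases hpd : A.PosDef
  · exact blockMatrix_mem_of_posDef (fun _ _ => blockMatrix_one_mem) hpd h1 h2
  · exact blockMatrix_mem_of_not_posDef hpd h1 h2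

/-- **Peres–Horodecki criterion in dimension 2×2.** A density matrix on `ℂ² ⊗ ℂ²` is
separable if and only if its partial transpose is positive semidefinite. -/
theorem separable_iff_ppt_two_two
    (ρ : Matrix (Fin 2 × Fin 2) (Fin 2 × Fin 2) ℂ)
    (hρ : IsDensity ρ) :
    Separable ρ ↔ (partialTransposeB ρ).PosSemidef := by
  exact ⟨fun h => h.posSemidef_partialTransposeB, fun h =>
    separable_of_mem_sepCone (mem_sepCone_of_partialTransposeB hρ.1 h) hρ.2⟩
end

section
/- Let ρ be a density matrix on ℂ^{d_A} ⊗ ℂ^{d_B}. If tr(ρ²) < 1/(d_A·d_B − 1), then ρ is separable. (Every state of sufficiently low purity in a bipartite system is separable.) -/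
open Matrix
open scoped BigOperators ComplexOrder Kronecker

/-- The second-order elementary symmetric function of the eigenvalues of a positive semidefinite
matrix is nonnegative. -/
lemma Matrix.PosSemidef.sum_minors_nonneg {m : Type*} [Fintype m] {M : Matrix m m ℂ}
    (hM : M.PosSemidef) : 0 ≤ ∑ i, ∑ k, (M i i * M k k - M i k * M k i) := by
  refine Finset.sum_nonneg fun i _ => Finset.sum_nonneg fun k _ => ?_
  have h := (hM.submatrix ![i, k]).det_nonneg
  rw [det_fin_two] at h
  exact h

lemma Pi.single_add_single_sub_eq_zero_iff {n : Type*} [DecidableEq n] (a b c d : n) :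
    (Pi.single b 1 + Pi.single d 1 - Pi.single a 1 - Pi.single c 1 : n → ZMod 3) = 0 ↔
      (a = b ∧ c = d) ∨ (a = d ∧ b = c) := by
  constructor
  · intro h
    by_cases hab : a = b
    · subst hab
      have hc := congrFun h c
      by_cases hcd : c = d <;> simp_all
    by_cases had : a = d
    · subst had
      have hb := congrFun h b
      by_cases hbc : b = c <;> simp_all
    have ha := congrFun h a
    by_cases hac : a = c <;> simp [Pi.single_apply, hab, had, hac] at ha
    · subst hac
      simp [hab, had] at ha
      exact absurd ha (by decide)
  · rintro (⟨rfl, rfl⟩ | ⟨rfl, rfl⟩) <;> abel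

/-- The characters of `(ℤ/3)ⁿ`, as vectors with unimodular entries, together with the standard
basis form a complex projective 2-design. -/
lemma sum_addChar_add_sum_diag {n : Type*} [Fintype n] [DecidableEq n] (T : n → n → n → n → ℂ) :
    ∑ ψ : AddChar (n → ZMod 3) ℂ, ∑ a, ∑ b, ∑ c, ∑ d,
        star (ψ (Pi.single a 1)) * ψ (Pi.single b 1) * (star (ψ (Pi.single c 1)) *
          ψ (Pi.single d 1)) * T a b c d
      + (Fintype.card (n → ZMod 3) : ℂ) * ∑ k, T k k k k
      = (Fintype.card (n → ZMod 3) : ℂ) * ∑ a, ∑ b, (T a a b b + T a b b a) := by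
  have key (a b c d : n) : ∑ ψ : AddChar (n → ZMod 3) ℂ,
      star (ψ (Pi.single a 1)) * ψ (Pi.single b 1) * (star (ψ (Pi.single c 1)) *
          ψ (Pi.single d 1)) * T a b c d =
      (Fintype.card (n → ZMod 3) : ℂ) * ((if a = b then if c = d then T a b c d else 0 else 0)
        + (if a = d then if b = c then T a b c d else 0 else 0)
        - (if a = b then if a = c then if a = d then T a b c d else 0 else 0 else 0)) := by
    rw [← Finset.sum_mul]
    have : ∀ ψ : AddChar (n → ZMod 3) ℂ, star (ψ (Pi.single a 1)) * ψ (Pi.single b 1) *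
        (star (ψ (Pi.single c 1)) * ψ (Pi.single d 1)) =
        ψ (Pi.single b 1 + Pi.single d 1 - Pi.single a 1 - Pi.single c 1) := by
      intro ψ
      simp only [sub_eq_add_neg, AddChar.map_add_eq_mul, AddChar.map_neg_eq_conj, starRingEnd_apply]
      ring
    simp_rw [this, AddChar.sum_apply_eq_ite, Pi.single_add_single_sub_eq_zero_iff]
    by_cases h1 : a = b <;> by_cases h2 : c = d <;> by_cases h3 : a = d <;> by_cases h4 : b = c <;>
      simp_all
  rw [Finset.sum_comm]
  simp_rw [Finset.sum_comm (s := (Finset.univ : Finset (AddChar (n → ZMod 3) ℂ)))]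
  simp_rw [key, ← Finset.mul_sum, ← mul_add]
  congr 1
  simp only [Finset.sum_add_distrib, Finset.sum_sub_distrib]
  simp

/-- The convex hull of a compact set in a finite-dimensional space is compact. -/
lemma IsCompact.convexHull_of_finiteDimensional {E : Type*} [AddCommGroup E] [Module ℝ E]
    [TopologicalSpace E] [IsTopologicalAddGroup E] [ContinuousSMul ℝ E] [FiniteDimensional ℝ E]
    {s : Set E} (hs : IsCompact s) : IsCompact (convexHull ℝ s) := by
  rcases s.eq_empty_or_nonempty with rfl | ⟨x₀, hx₀⟩
  · simp
  let N := Module.finrank ℝ E + 1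
  have hK : IsCompact ((stdSimplex ℝ (Fin N)) ×ˢ (Set.univ.pi fun _ : Fin N => s)) :=
    (isCompact_stdSimplex ℝ (Fin N)).prod (isCompact_univ_pi fun _ => hs)
  have hcont : Continuous fun p : (Fin N → ℝ) × (Fin N → E) => ∑ i, p.1 i • p.2 i := by
    fun_prop
  convert hK.image hcont
  ext x
  constructor
  · intro hx
    obtain ⟨ι, _, z, w, hz, hind, hw, hw1, rfl⟩ := eq_pos_convex_span_of_mem_convexHull hx
    have hcard : Fintype.card ι ≤ Fintype.card (Fin N) := by
      rw [Fintype.card_fin]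
      exact hind.card_le_finrank_succ.trans (Nat.succ_le_succ (Submodule.finrank_le _))
    obtain ⟨e⟩ := Function.Embedding.nonempty_of_card_le hcard
    refine ⟨(Function.extend e w 0, Function.extend e z fun _ => x₀), ⟨⟨fun i => ?_, ?_⟩, ?_⟩, ?_⟩
    · by_cases h : ∃ j, e j = i
      · obtain ⟨j, rfl⟩ := h
        simpa [e.injective.extend_apply] using (hw j).le
      · simp [Function.extend_apply' _ _ _ h]
    · rw [← hw1]
      refine (Fintype.sum_of_injective e e.injective _ _ (fun i hi => ?_) fun i => ?_).symm
      · simp [Function.extend_apply' _ _ _ hi]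
      · simp [e.injective.extend_apply]
    · intro i _
      by_cases h : ∃ j, e j = i
      · obtain ⟨j, rfl⟩ := h
        simpa [e.injective.extend_apply] using hz ⟨j, rfl⟩
      · simpa [Function.extend_apply' _ _ _ h] using hx₀
    · refine (Fintype.sum_of_injective e e.injective _ _ (fun i hi => ?_) fun i => ?_).symm
      · simp [Function.extend_apply' _ _ _ hi]
      · simp [e.injective.extend_apply]
  · rintro ⟨⟨w, z⟩, ⟨⟨hw, hw1⟩, hz⟩, rfl⟩
    exact mem_convexHull_of_exists_fintype w z hw hw1 (fun i => hz i trivial) rfl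

/-- The compression of a matrix on a product by a vector of the second factor. -/
noncomputable def Matrix.compressRight {m n : Type*} [Fintype n]
    (W : Matrix (m × n) (m × n) ℂ) (y : n → ℂ) : Matrix m m ℂ :=
  of fun i j => ∑ a, ∑ b, star (y a) * y b * W (i, a) (j, b)

/-- Nonnegativity on product vectors: `W` is block positive. -/
def BlockPositive {m n : Type*} [Fintype m] [Fintype n] (W : Matrix (m × n) (m × n) ℂ) : Prop :=
  W.IsHermitian ∧ ∀ (x : m → ℂ) (y : n → ℂ),
    0 ≤ ∑ i, ∑ j, ∑ a, ∑ b, star (x i) * x j * (star (y a) * y b * W (i, a) (j, b))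

lemma BlockPositive.posSemidef_compressRight {m n : Type*} [Fintype m] [Fintype n]
    {W : Matrix (m × n) (m × n) ℂ} (hW : BlockPositive W) (y : n → ℂ) :
    (W.compressRight y).PosSemidef := by
  refine PosSemidef.of_dotProduct_mulVec_nonneg ?_ fun x => ?_
  · ext i j
    simp only [compressRight, conjTranspose_apply, of_apply, star_sum, star_mul', star_star]
    rw [Finset.sum_comm]
    refine Finset.sum_congr rfl fun a _ => Finset.sum_congr rfl fun b _ => ?_
    rw [hW.1.apply]
    ring
  · convert hW.2 x y using 1
    simp only [dotProduct, mulVec, compressRight, of_apply, Finset.mul_sum, Finset.sum_mul,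
      Pi.star_apply]
    refine Finset.sum_congr rfl fun i _ => Finset.sum_congr rfl fun j _ =>
      Finset.sum_congr rfl fun a _ => Finset.sum_congr rfl fun b _ => ?_
    ring

lemma BlockPositive.submatrix_swap {m n : Type*} [Fintype m] [Fintype n]
    {W : Matrix (m × n) (m × n) ℂ} (hW : BlockPositive W) :
    BlockPositive (W.submatrix Prod.swap Prod.swap : Matrix (n × m) (n × m) ℂ) := by
  refine ⟨hW.1.submatrix _, fun x y => ?_⟩
  convert hW.2 y x using 1
  simp only [submatrix_apply, Prod.swap_prod_mk]
  have hcomm := Finset.sum_comm (s := Finset.univ) (t := Finset.univ)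
    (f := fun (p : n × n) (q : m × m) =>
      star (x p.1) * x p.2 * (star (y q.1) * y q.2 * W (q.1, p.1) (q.2, p.2)))
  simp only [Fintype.sum_prod_type] at hcomm
  rw [hcomm]
  refine Finset.sum_congr rfl fun a _ => Finset.sum_congr rfl fun b _ =>
    Finset.sum_congr rfl fun i _ => Finset.sum_congr rfl fun j _ => ?_
  ring

/-- Averaging the second symmetric function of the compressions over a 2-design. -/
lemma BlockPositive.sum_minors_nonneg {m n : Type*} [Fintype m] [Fintype n] [DecidableEq n]
    {W : Matrix (m × n) (m × n) ℂ} (hW : BlockPositive W) :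
    0 ≤ ∑ a, ∑ b, ∑ i, ∑ k, (W (i, a) (i, a) * W (k, b) (k, b) - W (i, a) (k, a) * W (k, b) (i, b)
      + (W (i, a) (i, b) * W (k, b) (k, a) - W (i, a) (k, b) * W (k, b) (i, a))) := by
  set T : n → n → n → n → ℂ := fun a b c d =>
    ∑ i, ∑ k, (W (i, a) (i, b) * W (k, c) (k, d) - W (i, a) (k, b) * W (k, c) (i, d)) with hT
  have hform (y : n → ℂ) : 0 ≤ ∑ a, ∑ b, ∑ c, ∑ d,
      star (y a) * y b * (star (y c) * y d) * T a b c d := by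
    convert (hW.posSemidef_compressRight y).sum_minors_nonneg using 1
    have hcomm := Finset.sum_comm (s := Finset.univ) (t := Finset.univ)
      (f := fun (q : n × n × n × n) (p : m × m) =>
        star (y q.1) * y q.2.1 * (star (y q.2.2.1) * y q.2.2.2) *
          (W (p.1, q.1) (p.1, q.2.1) * W (p.2, q.2.2.1) (p.2, q.2.2.2)
            - W (p.1, q.1) (p.2, q.2.1) * W (p.2, q.2.2.1) (p.1, q.2.2.2)))
    simp only [Fintype.sum_prod_type] at hcomm
    simp only [hT, Finset.mul_sum]
    rw [hcomm]
    refine Finset.sum_congr rfl fun i _ => Finset.sum_congr rfl fun k _ => ?_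
    simp only [compressRight, of_apply, Finset.sum_mul]
    simp only [Finset.mul_sum, ← Finset.sum_sub_distrib]
    refine Finset.sum_congr rfl fun a _ => Finset.sum_congr rfl fun b _ =>
      Finset.sum_congr rfl fun c _ => Finset.sum_congr rfl fun d _ => ?_
    ring
  have hdiag (k : n) : 0 ≤ T k k k k := by
    convert hform (Pi.single k 1) using 1
    simp [Pi.single_apply, apply_ite, ite_mul]
  have hN : (0 : ℂ) < Fintype.card (n → ZMod 3) := by
    exact_mod_cast Fintype.card_pos
  have hdes := sum_addChar_add_sum_diag T
  have h0 : 0 ≤ (Fintype.card (n → ZMod 3) : ℂ) * ∑ a, ∑ b, (T a a b b + T a b b a) := by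
    rw [← hdes]
    exact add_nonneg (Finset.sum_nonneg fun ψ _ => hform fun a => ψ (Pi.single a 1))
      (mul_nonneg hN.le (Finset.sum_nonneg fun k _ => hdiag k))
  have hinv : (0 : ℂ) ≤ (Fintype.card (n → ZMod 3) : ℂ)⁻¹ := by
    rw [← Complex.ofReal_natCast, ← Complex.ofReal_inv]
    exact Complex.zero_le_real.2 (by positivity)
  have h1 := mul_nonneg hinv h0
  rw [inv_mul_cancel_left₀ hN.ne'] at h1
  simpa only [hT, ← Finset.sum_add_distrib] using h1

/-- A block positive matrix has Hilbert–Schmidt norm at most its trace. -/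
lemma BlockPositive.trace_mul_self_le {m n : Type*} [Fintype m] [Fintype n]
    {W : Matrix (m × n) (m × n) ℂ} (hW : BlockPositive W) :
    (W * W).trace ≤ W.trace * W.trace := by
  classical
  have h1 := hW.sum_minors_nonneg
  have h2 := hW.submatrix_swap.sum_minors_nonneg
  simp only [submatrix_apply, Prod.swap_prod_mk] at h2
  have hcomm := Finset.sum_comm (s := Finset.univ) (t := Finset.univ)
    (f := fun (p : m × m) (q : n × n) =>
      W (p.1, q.1) (p.1, q.1) * W (p.2, q.2) (p.2, q.2)
        - W (p.1, q.1) (p.1, q.2) * W (p.2, q.2) (p.2, q.1)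
      + (W (p.1, q.1) (p.2, q.1) * W (p.2, q.2) (p.1, q.2)
        - W (p.1, q.1) (p.2, q.2) * W (p.2, q.2) (p.1, q.1)))
  simp only [Fintype.sum_prod_type] at hcomm
  rw [hcomm] at h2
  have h3 : (W.trace * W.trace - (W * W).trace) * 2 =
      ∑ a, ∑ b, ∑ i, ∑ k, (W (i, a) (i, a) * W (k, b) (k, b)
        - W (i, a) (k, b) * W (k, b) (i, a)) * 2 := by
    have hcomm' := Finset.sum_comm (s := Finset.univ) (t := Finset.univ)
      (f := fun (p : n × n) (q : m × m) =>
        (W (q.1, p.1) (q.1, p.1) * W (q.2, p.2) (q.2, p.2)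
          - W (q.1, p.1) (q.2, p.2) * W (q.2, p.2) (q.1, p.1)) * 2)
    simp only [Fintype.sum_prod_type] at hcomm'
    rw [hcomm']
    simp only [trace, diag_apply, mul_apply, Fintype.sum_prod_type, Finset.sum_mul]
    simp only [Finset.mul_sum, ← Finset.sum_sub_distrib, Finset.sum_mul]
    refine Finset.sum_congr rfl fun i _ => ?_
    rw [Finset.sum_comm]
  have h4 := add_nonneg h1 h2
  have h5 : (0 : ℂ) ≤ (W.trace * W.trace - (W * W).trace) * 2 := by
    rw [h3]
    convert h4 using 1
    simp only [← Finset.sum_add_distrib]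
    refine Finset.sum_congr rfl fun a _ => Finset.sum_congr rfl fun b _ =>
      Finset.sum_congr rfl fun i _ => Finset.sum_congr rfl fun k _ => ?_
    ring
  have h6 := mul_nonneg h5 (show (0 : ℂ) ≤ 2⁻¹ by
    rw [Complex.nonneg_iff]
    norm_num)
  rw [mul_inv_cancel_right₀ two_ne_zero] at h6
  exact sub_nonneg.1 h6

/-- The (unnormalized) pure product state of two vectors. -/
noncomputable def productState {m n : Type*} (x : m → ℂ) (y : n → ℂ) :
    Matrix (m × n) (m × n) ℂ :=
  vecMulVec x (star x) ⊗ₖ vecMulVec y (star y)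

/-- The unit sphere of `ℂᵐ`. -/
def unitVectors (m : Type*) [Fintype m] : Set (m → ℂ) := {x | ∑ i, ‖x i‖ ^ 2 = 1}

lemma isCompact_unitVectors (m : Type*) [Fintype m] : IsCompact (unitVectors m) := by
  refine (isCompact_univ_pi fun _ : m => isCompact_closedBall (0 : ℂ) 1).of_isClosed_subset
    (isClosed_eq (by fun_prop) continuous_const) fun x hx i _ => ?_
  rw [mem_closedBall_zero_iff]
  have h : ‖x i‖ ^ 2 ≤ 1 := by
    rw [← show ∑ i, ‖x i‖ ^ 2 = 1 from hx]
    exact Finset.single_le_sum (f := fun i => ‖x i‖ ^ 2) (fun _ _ => sq_nonneg _)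
      (Finset.mem_univ i)
  nlinarith [norm_nonneg (x i)]

lemma isDensity_vecMulVec_star {m : Type*} [Fintype m] {x : m → ℂ} (hx : x ∈ unitVectors m) :
    IsDensity (vecMulVec x (star x)) := by
  refine ⟨posSemidef_vecMulVec_self_star x, ?_⟩
  have h : ∑ i, ‖x i‖ ^ 2 = 1 := hx
  simp only [trace, diag_apply, vecMulVec_apply, Pi.star_apply, RCLike.star_def, Complex.mul_conj']
  exact_mod_cast h

lemma isHermitian_productState {m n : Type*} (x : m → ℂ) (y : n → ℂ) :
    (productState x y).IsHermitian := by
  ext ⟨i, a⟩ ⟨j, b⟩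
  simp [productState, vecMulVec_apply, mul_comm]

lemma trace_productState {m n : Type*} [Fintype m] [Fintype n] {x : m → ℂ} {y : n → ℂ}
    (hx : x ∈ unitVectors m) (hy : y ∈ unitVectors n) : (productState x y).trace = 1 := by
  rw [productState, trace_kronecker, (isDensity_vecMulVec_star hx).2,
    (isDensity_vecMulVec_star hy).2, one_mul]

lemma trace_mul_productState {m n : Type*} [Fintype m] [Fintype n]
    (W : Matrix (m × n) (m × n) ℂ) (x : m → ℂ) (y : n → ℂ) :
    (W * productState x y).trace =
      ∑ i, ∑ j, ∑ a, ∑ b, star (x i) * x j * (star (y a) * y b * W (i, a) (j, b)) := by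
  simp only [trace, diag_apply, mul_apply, Fintype.sum_prod_type]
  refine Finset.sum_congr rfl fun i _ => ?_
  rw [Finset.sum_comm]
  refine Finset.sum_congr rfl fun j _ => Finset.sum_congr rfl fun a _ =>
    Finset.sum_congr rfl fun b _ => ?_
  simp only [productState, kroneckerMap_apply, vecMulVec_apply, Pi.star_apply]
  ring

lemma productState_smul {m n : Type*} (r s : ℝ) (x : m → ℂ) (y : n → ℂ) :
    productState (r • x) (s • y) = (r ^ 2 * s ^ 2) • productState x y := by
  ext ⟨i, a⟩ ⟨j, b⟩
  simp [productState, vecMulVec_apply]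
  ring

lemma Matrix.IsHermitian.trace_mul_im {m : Type*} [Fintype m] {A B : Matrix m m ℂ}
    (hA : A.IsHermitian) (hB : B.IsHermitian) : ((A * B).trace).im = 0 := by
  rw [← Complex.conj_eq_iff_im, ← Complex.star_def, ← trace_conjTranspose, conjTranspose_mul,
    hA.eq, hB.eq, trace_mul_comm]

lemma exists_smul_mem_unitVectors {m : Type*} [Fintype m] {x : m → ℂ} (hx : x ≠ 0) :
    ∃ (r : ℝ) (z : m → ℂ), z ∈ unitVectors m ∧ x = r • z := by
  have hpos : 0 < ∑ i, ‖x i‖ ^ 2 := by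
    obtain ⟨i, hi⟩ := Function.ne_iff.1 hx
    exact Finset.sum_pos' (fun _ _ => sq_nonneg _)
      ⟨i, Finset.mem_univ i, pow_pos (norm_pos_iff.2 hi) 2⟩
  have hne : √(∑ i, ‖x i‖ ^ 2) ≠ 0 := (Real.sqrt_pos.2 hpos).ne'
  refine ⟨√(∑ i, ‖x i‖ ^ 2), (√(∑ i, ‖x i‖ ^ 2))⁻¹ • x, ?_, ?_⟩
  · simp only [unitVectors, Set.mem_ofPred_eq, Pi.smul_apply, norm_smul, mul_pow, norm_inv,
      ← Finset.mul_sum, Real.norm_eq_abs, sq_abs, inv_pow, Real.sq_sqrt hpos.le]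
    exact inv_mul_cancel₀ hpos.ne'
  · rw [smul_smul, mul_inv_cancel₀ hne, one_smul]

lemma blockPositive_of_unitVectors {m n : Type*} [Fintype m] [Fintype n]
    {W : Matrix (m × n) (m × n) ℂ} (hW : W.IsHermitian)
    (h : ∀ x ∈ unitVectors m, ∀ y ∈ unitVectors n, 0 ≤ ((W * productState x y).trace).re) :
    BlockPositive W := by
  refine ⟨hW, fun x y => ?_⟩
  by_cases hx : x = 0
  · simp [hx]
  by_cases hy : y = 0
  · simp [hy]
  rw [← trace_mul_productState, Complex.nonneg_iff]
  refine ⟨?_, (hW.trace_mul_im (isHermitian_productState x y)).symm⟩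
  obtain ⟨r, x, hx', rfl⟩ := exists_smul_mem_unitVectors hx
  obtain ⟨s, y, hy', rfl⟩ := exists_smul_mem_unitVectors hy
  rw [productState_smul, mul_smul_comm, trace_smul, Complex.smul_re]
  exact mul_nonneg (by positivity) (h x hx' y hy')

lemma single_mem_unitVectors {m : Type*} [Fintype m] [DecidableEq m] (i : m) :
    Pi.single i 1 ∈ unitVectors m := by
  simp [unitVectors, Pi.single_apply, apply_ite]

lemma trace_re_pos_of_unitVectors {m n : Type*} [Fintype m] [Fintype n] [Nonempty m] [Nonempty n]
    {W : Matrix (m × n) (m × n) ℂ}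
    (h : ∀ x ∈ unitVectors m, ∀ y ∈ unitVectors n, 0 < ((W * productState x y).trace).re) :
    0 < W.trace.re := by
  classical
  rw [trace, Complex.re_sum]
  refine Finset.sum_pos (fun p _ => ?_) Finset.univ_nonempty
  have hp := h _ (single_mem_unitVectors p.1) _ (single_mem_unitVectors p.2)
  rw [trace_mul_productState] at hp
  simpa [Pi.single_apply, apply_ite, ite_mul] using hp

/-- Real functionals on Hermitian matrices are given by pairing with Hermitian matrices. -/
lemma exists_isHermitian_forall_apply_eq {m : Type*} [Fintype m] (f : Matrix m m ℂ →ₗ[ℝ] ℝ) :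
    ∃ W : Matrix m m ℂ, W.IsHermitian ∧
      ∀ X : Matrix m m ℂ, X.IsHermitian → f X = ((W * X).trace).re := by
  classical
  let F : Module.Dual ℂ (Matrix m m ℂ) := Module.Dual.extendRCLike f
  let V : Matrix m m ℂ := of fun i j => F (single j i 1)
  have hV (X : Matrix m m ℂ) : F X = (V * X).trace := by
    conv_lhs => rw [matrix_eq_sum_single X]
    simp only [map_sum, trace, diag_apply, mul_apply]
    rw [Finset.sum_comm]
    refine Finset.sum_congr rfl fun i _ => Finset.sum_congr rfl fun j _ => ?_
    rw [show single j i (X j i) = X j i • single j i (1 : ℂ) by simp, map_smul, smul_eq_mul,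
      mul_comm]
    rfl
  refine ⟨(2⁻¹ : ℝ) • (V + Vᴴ), ?_, fun X hX => ?_⟩
  · rw [IsHermitian, conjTranspose_smul, conjTranspose_add, conjTranspose_conjTranspose, add_comm]
    simp
  · have h1 : f X = ((V * X).trace).re := by
      rw [← hV]
      exact (Module.Dual.re_extendRCLike_apply (𝕜 := ℂ) f X).symm
    have h2 : ((Vᴴ * X).trace).re = ((V * X).trace).re := by
      rw [← Complex.conj_re, ← Complex.star_def, ← trace_conjTranspose, conjTranspose_mul,
        conjTranspose_conjTranspose, hX.eq, trace_mul_comm]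
    rw [smul_mul_assoc, trace_smul, Complex.smul_re, add_mul, trace_add, Complex.add_re, h2, h1,
      smul_eq_mul]
    ring

/-- A Hermitian matrix of unit trace outside the convex hull of the pure product states is
detected by an entanglement witness. -/
lemma exists_witness {m n : Type*} [Fintype m] [Fintype n]
    {ρ : Matrix (m × n) (m × n) ℂ} (hρ : ρ.IsHermitian) (htr : ρ.trace = 1)
    (hmem : ρ ∉ convexHull ℝ
      ((fun p : (m → ℂ) × (n → ℂ) => productState p.1 p.2) '' unitVectors m ×ˢ unitVectors n)) :
    ∃ W : Matrix (m × n) (m × n) ℂ, W.IsHermitian ∧ ((W * ρ).trace).re < 0 ∧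
      ∀ x ∈ unitVectors m, ∀ y ∈ unitVectors n, 0 < ((W * productState x y).trace).re := by
  classical
  have hcont : Continuous fun p : (m → ℂ) × (n → ℂ) => productState p.1 p.2 := by
    refine continuous_matrix fun i j => ?_
    simp only [productState, kroneckerMap_apply, vecMulVec_apply, Pi.star_apply]
    fun_prop
  have hK := (((isCompact_unitVectors m).prod
    (isCompact_unitVectors n)).image hcont).convexHull_of_finiteDimensional
  have : LocallyConvexSpace ℝ (Matrix (m × n) (m × n) ℂ) :=
    inferInstanceAs (LocallyConvexSpace ℝ (m × n → m × n → ℂ))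
  obtain ⟨f, u, hfρ, hf⟩ :=
    geometric_hahn_banach_point_closed (convex_convexHull ℝ _) hK.isClosed hmem
  obtain ⟨W, hW, hfW⟩ := exists_isHermitian_forall_apply_eq f.toLinearMap
  have hshift (X : Matrix (m × n) (m × n) ℂ) (hX : X.IsHermitian) (hX1 : X.trace = 1) :
      (((W - u • (1 : Matrix (m × n) (m × n) ℂ)) * X).trace).re = f X - u := by
    rw [sub_mul, smul_mul_assoc, one_mul, trace_sub, trace_smul, hX1, Complex.sub_re,
      Complex.smul_re, ← hfW X hX]
    simp
  refine ⟨W - u • (1 : Matrix (m × n) (m × n) ℂ), hW.sub ?_, ?_, fun x hx y hy => ?_⟩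
  · simp [IsHermitian, conjTranspose_smul]
  · rw [hshift ρ hρ htr]
    linarith
  · rw [hshift _ (isHermitian_productState x y) (trace_productState hx hy)]
    linarith [hf _ (subset_convexHull ℝ _ ⟨(x, y), ⟨hx, hy⟩, rfl⟩)]

lemma Matrix.IsHermitian.trace_mul_self_re_nonneg {m : Type*} [Fintype m] {Y : Matrix m m ℂ}
    (hY : Y.IsHermitian) : 0 ≤ ((Y * Y).trace).re := by
  have h := (posSemidef_conjTranspose_mul_self Y).trace_nonneg
  rw [hY.eq] at h
  exact (Complex.nonneg_iff.1 h).1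

lemma separable_of_mem_convexHull {dA dB : ℕ}
    {ρ : Matrix (Fin dA × Fin dB) (Fin dA × Fin dB) ℂ}
    (h : ρ ∈ convexHull ℝ ((fun p : (Fin dA → ℂ) × (Fin dB → ℂ) => productState p.1 p.2) ''
      unitVectors (Fin dA) ×ˢ unitVectors (Fin dB))) : Separable ρ := by
  obtain ⟨ι, _, w, z, hw, hw1, hz, rfl⟩ := mem_convexHull_iff_exists_fintype.1 h
  choose p hp hpz using hz
  let e := (Fintype.equivFin ι).symm
  refine ⟨Fintype.card ι, fun j => w (e j), fun j => vecMulVec (p (e j)).1 (star (p (e j)).1),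
    fun j => vecMulVec (p (e j)).2 (star (p (e j)).2), fun j => hw _, ?_,
    fun j => isDensity_vecMulVec_star (hp _).1, fun j => isDensity_vecMulVec_star (hp _).2, ?_⟩
  · rw [← hw1]
    exact e.sum_comp w
  · rw [← e.sum_comp]
    refine Finset.sum_congr rfl fun j _ => ?_
    rw [← hpz, Complex.coe_smul]
    rfl

/-- **Gurvits–Barnum low-purity separability.** Any bipartite density matrix with
`tr(ρ²) < 1/(d_A d_B − 1)` is separable. -/
theorem low_purity_separable {dA dB : ℕ}
    (ρ : Matrix (Fin dA × Fin dB) (Fin dA × Fin dB) ℂ)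
    (hρ : IsDensity ρ)
    (hpur : ((ρ * ρ).trace).re < 1 / ((dA : ℝ) * dB - 1)) :
    Separable ρ := by
  by_contra hsep
  obtain ⟨W, hW, hneg, hpos⟩ := exists_witness hρ.1.isHermitian hρ.2
    fun h => hsep (separable_of_mem_convexHull h)
  have hne : Nonempty (Fin dA × Fin dB) := by
    by_contra hempty
    rw [not_nonempty_iff] at hempty
    have := hρ.2
    simp [trace] at this
  have : Nonempty (Fin dA) := hne.map Prod.fst
  have : Nonempty (Fin dB) := hne.map Prod.snd
  have hBP := blockPositive_of_unitVectors hW fun x hx y hy => (hpos x hx y hy).le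
  have hw := trace_re_pos_of_unitVectors hpos
  have hW_im : W.trace.im = 0 := by
    simpa using hW.trace_mul_im (isHermitian_one (n := Fin dA × Fin dB) (α := ℂ))
  have hq : ((W * W).trace).re ≤ W.trace.re ^ 2 := by
    have h := (Complex.le_def.1 hBP.trace_mul_self_le).1
    rw [Complex.mul_re, hW_im] at h
    nlinarith
  have hD : (1 : ℝ) ≤ (dA : ℝ) * dB := by
    have h : 0 < dA * dB := by
      simpa using Fintype.card_pos (α := Fin dA × Fin dB)
    exact_mod_cast h
  have hp0 := hρ.1.isHermitian.trace_mul_self_re_nonneg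
  have hD1 : 0 < (dA : ℝ) * dB - 1 := one_div_pos.1 (hp0.trans_lt hpur)
  have hp : 0 < ((ρ * ρ).trace).re := by
    refine hp0.lt_of_ne fun h => ?_
    have h0 : (ρᴴ * ρ).trace = 0 := by
      rw [hρ.1.isHermitian.eq]
      exact Complex.ext h.symm (hρ.1.isHermitian.trace_mul_im hρ.1.isHermitian)
    have := hρ.2
    simp [trace_conjTranspose_mul_self_eq_zero_iff.1 h0] at this
  rw [lt_div_iff₀ hD1] at hpur
  set w := W.trace.re with hw_def
  set p := ((ρ * ρ).trace).re with hp_def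
  have hY : ((p • W - (w * p) • (1 : Matrix (Fin dA × Fin dB) (Fin dA × Fin dB) ℂ)
      + w • ρ)).IsHermitian := by
    simp [IsHermitian, conjTranspose_smul, hW.eq, hρ.1.isHermitian.eq]
  have hsq := hY.trace_mul_self_re_nonneg
  simp only [mul_add, add_mul, mul_sub, sub_mul, smul_mul_assoc, mul_smul_comm, one_mul, mul_one,
    trace_add, trace_sub, trace_smul, Complex.add_re, Complex.sub_re, Complex.smul_re, smul_eq_mul,
    trace_mul_comm ρ W, trace_one, hρ.2, Fintype.card_prod, Fintype.card_fin, Nat.cast_mul,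
    Complex.mul_re, Complex.natCast_re, Complex.natCast_im, Complex.one_re, ← hw_def,
    ← hp_def] at hsq
  have h1 := mul_le_mul_of_nonneg_left hq (sq_nonneg p)
  have h2 : w * p * ((W * ρ).trace).re < 0 := mul_neg_of_pos_of_neg (mul_pos hw hp) hneg
  have h3 := mul_lt_mul_of_pos_left hpur (mul_pos (sq_pos_of_pos hw) hp)
  nlinarith
end
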